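/- For a dcpo P, the following are equivalent: (1) P is a quasicontinuous domain; (2) for every x ∈ P and every Scott open set U with x ∈ U, there exists a nonempty finite subset F ⊆ P such that x ∈ int_{σ(P)}(↑F) ⊆ ↑F ⊆ U. -/

import Mathlib

open Set

/-- The upper set `↑A` generated by a subset `A` of a preordered set. -/
def upSet {P : Type*} [Preorder P] (A : Set P) : Set P := {y | ∃ a ∈ A, a ≤ y}

/-- The lower set `↓A` generated by a subset `A` of a preordered set. -/
def downSet {P : Type*} [Preorder P] (A : Set P) : Set P := {y | ∃ a ∈ A, y ≤ a}

/-- A poset is a dcpo if every (nonempty) directed subset has a least upper bound. -/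
def IsDcpo (P : Type*) [Preorder P] : Prop :=
  ∀ D : Set P, D.Nonempty → DirectedOn (· ≤ ·) D → ∃ s, IsLUB D s

/-- A subset `U` is Scott open if it is an upper set and every directed set whose
supremum lies in `U` meets `U`. -/
def ScottOpen {P : Type*} [Preorder P] (U : Set P) : Prop :=
  IsUpperSet U ∧ ∀ D : Set P, ∀ s : P, D.Nonempty → DirectedOn (· ≤ ·) D →
    IsLUB D s → s ∈ U → (D ∩ U).Nonempty

/-- The Scott topology `σ(P)`. -/
def scottT (P : Type*) [Preorder P] : TopologicalSpace P where
  IsOpen := ScottOpen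
  isOpen_univ := ⟨isUpperSet_univ, fun D _ hD _ _ _ => hD.imp fun _ hd => ⟨hd, trivial⟩⟩
  isOpen_inter := by
    rintro U V ⟨hU, hU'⟩ ⟨hV, hV'⟩
    refine ⟨hU.inter hV, fun D s hD hdir hlub hs => ?_⟩
    obtain ⟨d₁, hd₁D, hd₁U⟩ := hU' D s hD hdir hlub hs.1
    obtain ⟨d₂, hd₂D, hd₂V⟩ := hV' D s hD hdir hlub hs.2
    obtain ⟨d, hdD, h₁, h₂⟩ := hdir d₁ hd₁D d₂ hd₂D
    exact ⟨d, hdD, hU h₁ hd₁U, hV h₂ hd₂V⟩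
  isOpen_sUnion := by
    intro S hS
    refine ⟨isUpperSet_sUnion fun U hU => (hS U hU).1, fun D s hD hdir hlub hs => ?_⟩
    obtain ⟨U, hUS, hsU⟩ := hs
    obtain ⟨d, hdD, hdU⟩ := (hS U hUS).2 D s hD hdir hlub hsU
    exact ⟨d, hdD, U, hUS, hdU⟩

/-- Scott interior. -/
def scottInt (P : Type*) [Preorder P] (A : Set P) : Set P := @interior P (scottT P) A

/-- Scott closure. -/
def scottCl (P : Type*) [Preorder P] (A : Set P) : Set P := @closure P (scottT P) A

/-- The lower topology `ω(P)`, generated by the complements of principal upper sets. -/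
def lowerT (P : Type*) [Preorder P] : TopologicalSpace P :=
  .generateFrom {V | ∃ x : P, V = (Ici x)ᶜ}

/-- The upper topology `υ(P)`, generated by the complements of principal lower sets. -/
def upperT (P : Type*) [Preorder P] : TopologicalSpace P :=
  .generateFrom {V | ∃ x : P, V = (Iic x)ᶜ}

/-- The Lawson topology `λ(P)`, generated by `σ(P) ∪ ω(P)`. -/
def lawsonT (P : Type*) [Preorder P] : TopologicalSpace P :=
  .generateFrom ({U | ScottOpen U} ∪ {V | ∃ x : P, V = (Ici x)ᶜ})

/-- The interval topology `θ(P)`, generated by `ω(P) ∪ υ(P)`. -/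
def intervalT (P : Type*) [Preorder P] : TopologicalSpace P :=
  .generateFrom ({V | ∃ x : P, V = (Ici x)ᶜ} ∪ {V | ∃ x : P, V = (Iic x)ᶜ})

/-- `A ≪ B`: for every directed set `D` with `sup D ∈ ↑B`, `D` meets `↑A`. -/
def WayBelowSet {P : Type*} [Preorder P] (A B : Set P) : Prop :=
  ∀ D : Set P, ∀ s : P, D.Nonempty → DirectedOn (· ≤ ·) D → IsLUB D s →
    s ∈ upSet B → (D ∩ upSet A).Nonempty

/-- `u ≪ x`: every directed set `D` with `sup D ≥ x` contains some `d ≥ u`. -/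
def WayBelowPt {P : Type*} [Preorder P] (u x : P) : Prop :=
  ∀ D : Set P, ∀ s : P, D.Nonempty → DirectedOn (· ≤ ·) D → IsLUB D s →
    x ≤ s → ∃ d ∈ D, u ≤ d

/-- A family of sets is filtered if it is (nonempty and) directed under reverse inclusion. -/
def Filtered {P : Type*} (𝒜 : Set (Set P)) : Prop :=
  𝒜.Nonempty ∧ ∀ S ∈ 𝒜, ∀ T ∈ 𝒜, ∃ R ∈ 𝒜, R ⊆ S ∧ R ⊆ T

/-- The family `{↑F : F nonempty finite, F ≪ x}`. -/
def finWayFamily {P : Type*} [Preorder P] (x : P) : Set (Set P) :=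
  {S | ∃ F : Set P, F.Nonempty ∧ F.Finite ∧ WayBelowSet F {x} ∧ S = upSet F}

/-- A quasicontinuous domain. -/
def IsQuasicontinuousDomain (P : Type*) [Preorder P] : Prop :=
  ∀ x : P, Filtered (finWayFamily x) ∧ Ici x = ⋂₀ finWayFamily x

/-- The family `{↑F : F nonempty finite, x ∈ ↑F, F ≪ F}`. -/
def finCompactFamily {P : Type*} [Preorder P] (x : P) : Set (Set P) :=
  {S | ∃ F : Set P, F.Nonempty ∧ F.Finite ∧ x ∈ upSet F ∧ WayBelowSet F F ∧ S = upSet F}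

/-- A quasialgebraic domain. -/
def IsQuasialgebraicDomain (P : Type*) [Preorder P] : Prop :=
  ∀ x : P, Filtered (finCompactFamily x) ∧ Ici x = ⋂₀ finCompactFamily x

/-- A continuous domain: every `⇓x` is directed (hence nonempty) with supremum `x`. -/
def IsContinuousDomain (P : Type*) [Preorder P] : Prop :=
  ∀ x : P, {u | WayBelowPt u x}.Nonempty ∧ DirectedOn (· ≤ ·) {u | WayBelowPt u x} ∧
    IsLUB {u | WayBelowPt u x} x

/-- The set `K(P)` of compact elements. -/
def compacts (P : Type*) [Preorder P] : Set P := {k | WayBelowPt k k}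

/-- An algebraic domain. -/
def IsAlgebraicDomain (P : Type*) [Preorder P] : Prop :=
  ∀ x : P, (compacts P ∩ Iic x).Nonempty ∧ DirectedOn (· ≤ ·) (compacts P ∩ Iic x) ∧
    IsLUB (compacts P ∩ Iic x) x

/-- A meet-continuous dcpo: whenever `x ≤ sup D` for a directed set `D`,
`x` lies in the Scott closure of `↓x ∩ ↓D`. -/
def MeetContinuous (P : Type*) [Preorder P] : Prop :=
  ∀ x : P, ∀ D : Set P, ∀ s : P, D.Nonempty → DirectedOn (· ≤ ·) D → IsLUB D s → x ≤ s →
    x ∈ scottCl P (Iic x ∩ downSet D)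

/-- The set of dyadic rationals in `[0,1]`. -/
def dyadics : Set ℝ := {t | ∃ m n : ℕ, m ≤ 2 ^ n ∧ t = (m : ℝ) / 2 ^ n}

theorem mem_upSet_singleton {P : Type*} [Preorder P] {x y : P} : y ∈ upSet {x} ↔ x ≤ y := by
  simp [upSet]

theorem isUpperSet_upSet {P : Type*} [Preorder P] (A : Set P) : IsUpperSet (upSet A) :=
  fun _ _ hab ⟨c, hc, hca⟩ => ⟨c, hc, hca.trans hab⟩

/-- A chain of sets, each meeting a finite set `F`, has an intersection meeting `F`. -/
theorem IsChain.sInter_inter_nonempty_of_finite {α : Type*} {c : Set (Set α)} {F : Set α}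
    (hc : IsChain (· ⊆ ·) c) (hne : c.Nonempty) (hF : F.Finite)
    (h : ∀ L ∈ c, (L ∩ F).Nonempty) : (⋂₀ c ∩ F).Nonempty := by
  have hfin : ((fun L => L ∩ F) '' c).Finite :=
    hF.finite_subsets.subset (by rintro _ ⟨L, -, rfl⟩; exact inter_subset_right)
  obtain ⟨_, ⟨L₀, hL₀, rfl⟩, hmin⟩ := hfin.exists_minimal (hne.image _)
  obtain ⟨f, hfL, hfF⟩ := h L₀ hL₀
  refine ⟨f, fun L hL => ?_, hfF⟩
  rcases hc.total hL hL₀ with hle | hle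
  · exact (hmin ⟨L, hL, rfl⟩ (inter_subset_inter_left F hle) ⟨hfL, hfF⟩).1
  · exact hle hfL

/-- **Rudin's lemma**: a lower set `B` meeting every member of a filtered family of finitely
generated upper sets contains a directed set meeting every member of the family. -/
theorem Filtered.exists_directedOn_subset {P : Type*} [Preorder P] {𝓕 : Set (Set P)}
    (h𝓕 : Filtered 𝓕) (hfin : ∀ S ∈ 𝓕, ∃ F : Set P, F.Finite ∧ S = upSet F)
    {B : Set P} (hB : IsLowerSet B) (hmeet : ∀ S ∈ 𝓕, (B ∩ S).Nonempty) :
    ∃ D ⊆ B, DirectedOn (· ≤ ·) D ∧ ∀ S ∈ 𝓕, (D ∩ S).Nonempty := by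
  obtain ⟨L, hLB, hL⟩ := zorn_superset_nonempty
    {L : Set P | IsLowerSet L ∧ ∀ S ∈ 𝓕, (L ∩ S).Nonempty} (by
      intro c hcS hc hne
      refine ⟨⋂₀ c, ⟨isLowerSet_sInter fun L hL => (hcS hL).1, fun S hS => ?_⟩,
        fun L hL => sInter_subset_of_mem hL⟩
      obtain ⟨F, hF, rfl⟩ := hfin S hS
      obtain ⟨f, hfc, hfF⟩ := hc.sInter_inter_nonempty_of_finite hne hF fun L hL => by
        obtain ⟨y, hyL, f, hfF, hfy⟩ := (hcS hL).2 _ hS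
        exact ⟨f, (hcS hL).1 hfy hyL, hfF⟩
      exact ⟨f, hfc, f, hfF, le_rfl⟩) B ⟨hB, hmeet⟩
  have key : ∀ a ∈ L, ∃ S ∈ 𝓕, L ∩ S ⊆ Ici a := by
    intro a ha
    by_contra! hcon
    have hmem : IsLowerSet (L \ Ici a) ∧ ∀ S ∈ 𝓕, ((L \ Ici a) ∩ S).Nonempty := by
      refine ⟨hL.prop.1.inter (isUpperSet_Ici a).compl, fun S hS => ?_⟩
      obtain ⟨y, ⟨hyL, hyS⟩, hya⟩ := not_subset.1 (hcon S hS)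
      exact ⟨y, ⟨hyL, hya⟩, hyS⟩
    exact (hL.le_of_le hmem sdiff_subset ha).2 self_mem_Ici
  refine ⟨L, hLB, fun a ha b hb => ?_, hL.prop.2⟩
  obtain ⟨S, hS, hSa⟩ := key a ha
  obtain ⟨T, hT, hTb⟩ := key b hb
  obtain ⟨R, hR, hRS, hRT⟩ := h𝓕.2 S hS T hT
  obtain ⟨y, hyL, hyR⟩ := hL.prop.2 R hR
  exact ⟨y, hyL, hSa ⟨hyL, hRS hyR⟩, hTb ⟨hyL, hRT hyR⟩⟩

/-- In a dcpo, if a filtered family of finitely generated upper sets has its intersection inside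
`↑x`, then every upper set that meets all directed sets with supremum above `x` contains a member
of the family. -/
theorem Filtered.exists_subset_of_sInter_subset_Ici {P : Type*} [Preorder P] (hdcpo : IsDcpo P)
    {𝓕 : Set (Set P)} (h𝓕 : Filtered 𝓕)
    (hfin : ∀ S ∈ 𝓕, ∃ F : Set P, F.Finite ∧ S = upSet F) {x : P} (hx : ⋂₀ 𝓕 ⊆ Ici x)
    {A : Set P} (hA : IsUpperSet A)
    (hxA : ∀ D : Set P, ∀ s : P, D.Nonempty → DirectedOn (· ≤ ·) D → IsLUB D s →
      x ≤ s → (D ∩ A).Nonempty) : ∃ S ∈ 𝓕, S ⊆ A := by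
  by_contra! hcon
  obtain ⟨D, hDA, hD, hmeet⟩ := h𝓕.exists_directedOn_subset hfin hA.compl fun S hS => by
    obtain ⟨y, hyS, hyA⟩ := not_subset.1 (hcon S hS)
    exact ⟨y, hyA, hyS⟩
  have hne : D.Nonempty := by
    obtain ⟨S, hS⟩ := h𝓕.1
    exact (hmeet S hS).mono inter_subset_left
  obtain ⟨s, hs⟩ := hdcpo D hne hD
  have hxs : x ≤ s := hx fun S hS => by
    obtain ⟨y, hyD, hyS⟩ := hmeet S hS
    obtain ⟨F, -, rfl⟩ := hfin S hS
    exact isUpperSet_upSet F (hs.1 hyD) hyS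
  obtain ⟨d, hdD, hdA⟩ := hxA D s hne hD hs hxs
  exact hDA hdD hdA

theorem scottOpen_compl_Iic {P : Type*} [Preorder P] (y : P) : ScottOpen (Iic y)ᶜ := by
  refine ⟨(isLowerSet_Iic y).compl, fun D s _ _ hs hsy => ?_⟩
  by_contra hcon
  exact hsy (hs.2 fun d hd => by_contra fun hdy => hcon ⟨d, hd, hdy⟩)

theorem mem_scottInt {P : Type*} [Preorder P] {A : Set P} {x : P} :
    x ∈ scottInt P A ↔ ∃ U ⊆ A, ScottOpen U ∧ x ∈ U :=
  @mem_interior P (scottT P) x A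

theorem WayBelowSet.singleton_mono {P : Type*} [Preorder P] {F : Set P} {x y : P}
    (h : WayBelowSet F {x}) (hxy : x ≤ y) : WayBelowSet F {y} :=
  fun D s hne hD hs hys =>
    h D s hne hD hs (mem_upSet_singleton.2 (hxy.trans (mem_upSet_singleton.1 hys)))

theorem WayBelowSet.of_upSet_subset {P : Type*} [Preorder P] {F G A : Set P}
    (h : WayBelowSet G A) (hGF : upSet G ⊆ upSet F) : WayBelowSet F A :=
  fun D s hne hD hs hsA => (h D s hne hD hs hsA).mono (inter_subset_inter_right D hGF)

theorem WayBelowSet.mem_upSet {P : Type*} [Preorder P] {F : Set P} {x : P}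
    (h : WayBelowSet F {x}) : x ∈ upSet F := by
  obtain ⟨y, rfl, hy⟩ := h {x} x (singleton_nonempty x) (directedOn_singleton x)
    isLUB_singleton (mem_upSet_singleton.2 le_rfl)
  exact hy

theorem wayBelowSet_singleton_of_mem_scottInt {P : Type*} [Preorder P] {F : Set P} {x : P}
    (h : x ∈ scottInt P (upSet F)) : WayBelowSet F {x} := by
  obtain ⟨U, hUF, hU, hxU⟩ := mem_scottInt.1 h
  exact fun D s hne hD hs hxs => (hU.2 D s hne hD hs
    (hU.1 (mem_upSet_singleton.1 hxs) hxU)).mono (inter_subset_inter_right D hUF)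

theorem exists_finite_of_mem_finWayFamily {P : Type*} [Preorder P] {x : P} {S : Set P}
    (hS : S ∈ finWayFamily x) : ∃ F : Set P, F.Finite ∧ S = upSet F := by
  obtain ⟨F, -, hF, -, rfl⟩ := hS
  exact ⟨F, hF, rfl⟩

theorem finWayFamily_mono {P : Type*} [Preorder P] {x y : P} (hxy : x ≤ y) :
    finWayFamily x ⊆ finWayFamily y := by
  rintro _ ⟨F, hne, hF, hFx, rfl⟩
  exact ⟨F, hne, hF, hFx.singleton_mono hxy, rfl⟩

theorem IsQuasicontinuousDomain.scottOpen_setOf_wayBelowSet {P : Type*} [Preorder P]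
    (hdcpo : IsDcpo P) (h : IsQuasicontinuousDomain P) (F : Set P) :
    ScottOpen {y : P | WayBelowSet F {y}} := by
  refine ⟨fun a b hab ha => WayBelowSet.singleton_mono ha hab, fun D s hne hD hs hFs => ?_⟩
  have hfilt : Filtered (⋃ d ∈ D, finWayFamily d) := by
    constructor
    · obtain ⟨d, hd⟩ := hne
      obtain ⟨S, hS⟩ := (h d).1.1
      exact ⟨S, mem_biUnion hd hS⟩
    · intro S hS T hT
      obtain ⟨a, ha, hSa⟩ := mem_iUnion₂.1 hS
      obtain ⟨b, hb, hTb⟩ := mem_iUnion₂.1 hT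
      obtain ⟨d, hd, had, hbd⟩ := hD a ha b hb
      obtain ⟨R, hR, hRST⟩ :=
        (h d).1.2 S (finWayFamily_mono had hSa) T (finWayFamily_mono hbd hTb)
      exact ⟨R, mem_biUnion hd hR, hRST⟩
  obtain ⟨S, hS, hSF⟩ := hfilt.exists_subset_of_sInter_subset_Ici hdcpo
    (fun S hS => by
      obtain ⟨d, -, hSd⟩ := mem_iUnion₂.1 hS
      exact exists_finite_of_mem_finWayFamily hSd)
    (x := s)
    (fun y hy => hs.2 fun d hd => by
      have hyd : y ∈ ⋂₀ finWayFamily d := fun S hS => hy S (mem_biUnion hd hS)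
      rwa [← (h d).2] at hyd)
    (isUpperSet_upSet F)
    (fun E t hne hE ht hst => hFs E t hne hE ht (mem_upSet_singleton.2 hst))
  obtain ⟨d, hd, G, -, -, hGd, rfl⟩ := mem_iUnion₂.1 hS
  exact ⟨d, hd, hGd.of_upSet_subset hSF⟩

/-- A dcpo is a quasicontinuous domain iff for every `x` and Scott open `U ∋ x`
there is a nonempty finite `F` with `x ∈ int_σ(↑F) ⊆ ↑F ⊆ U`. -/
theorem quasicontinuous_iff_scottOpen_refinement
    (P : Type*) [PartialOrder P] (hdcpo : IsDcpo P) :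
    IsQuasicontinuousDomain P ↔
      ∀ x : P, ∀ U : Set P, ScottOpen U → x ∈ U →
        ∃ F : Set P, F.Nonempty ∧ F.Finite ∧
          x ∈ scottInt P (upSet F) ∧ upSet F ⊆ U := by
  constructor
  · intro h x U hU hxU
    obtain ⟨_, ⟨F, hne, hF, hFx, rfl⟩, hFU⟩ := (h x).1.exists_subset_of_sInter_subset_Ici hdcpo
      (fun S hS => exists_finite_of_mem_finWayFamily hS) (h x).2.ge hU.1
      (fun D s hne hD hs hxs => hU.2 D s hne hD hs (hU.1 hxs hxU))
    exact ⟨F, hne, hF, mem_scottInt.2 ⟨_, fun y hy => WayBelowSet.mem_upSet hy,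
      h.scottOpen_setOf_wayBelowSet hdcpo F, hFx⟩, hFU⟩
  · intro h x
    let 𝓑 : Set (Set P) :=
      {S | ∃ F : Set P, F.Nonempty ∧ F.Finite ∧ x ∈ scottInt P (upSet F) ∧ S = upSet F}
    have hsub : 𝓑 ⊆ finWayFamily x := by
      rintro _ ⟨F, hne, hF, hxF, rfl⟩
      exact ⟨F, hne, hF, wayBelowSet_singleton_of_mem_scottInt hxF, rfl⟩
    have hfilt : Filtered 𝓑 := by
      constructor
      · obtain ⟨F, hne, hF, hxF, -⟩ := h x univ (scottT P).isOpen_univ (mem_univ x)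
        exact ⟨_, F, hne, hF, hxF, rfl⟩
      · rintro _ ⟨F, -, -, hxF, rfl⟩ _ ⟨G, -, -, hxG, rfl⟩
        obtain ⟨U, hUF, hU, hxU⟩ := mem_scottInt.1 hxF
        obtain ⟨V, hVG, hV, hxV⟩ := mem_scottInt.1 hxG
        obtain ⟨H, hne, hH, hxH, hHUV⟩ := h x (U ∩ V) ((scottT P).isOpen_inter U V hU hV) ⟨hxU, hxV⟩
        exact ⟨_, ⟨H, hne, hH, hxH, rfl⟩, fun y hy => hUF (hHUV hy).1,
          fun y hy => hVG (hHUV hy).2⟩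
    have hInter : ⋂₀ 𝓑 ⊆ Ici x := by
      intro y hy
      by_contra hxy
      obtain ⟨F, hne, hF, hxF, hFy⟩ := h x (Iic y)ᶜ (scottOpen_compl_Iic y) hxy
      exact hFy (hy _ ⟨F, hne, hF, hxF, rfl⟩) self_mem_Iic
    have hrefine : ∀ S ∈ finWayFamily x, ∃ R ∈ 𝓑, R ⊆ S := by
      rintro _ ⟨F, -, -, hFx, rfl⟩
      exact hfilt.exists_subset_of_sInter_subset_Ici hdcpo
        (fun S hS => exists_finite_of_mem_finWayFamily (hsub hS)) hInter (isUpperSet_upSet F)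
        (fun D s hne hD hs hxs => hFx D s hne hD hs (mem_upSet_singleton.2 hxs))
    refine ⟨⟨hfilt.1.mono hsub, fun S hS T hT => ?_⟩,
      Subset.antisymm ?_ ((sInter_subset_sInter hsub).trans hInter)⟩
    · obtain ⟨S', hS', hSS⟩ := hrefine S hS
      obtain ⟨T', hT', hTT⟩ := hrefine T hT
      obtain ⟨R, hR, hRS, hRT⟩ := hfilt.2 S' hS' T' hT'
      exact ⟨R, hsub hR, hRS.trans hSS, hRT.trans hTT⟩
    · rintro y hxy _ ⟨F, -, -, hFx, rfl⟩
      exact isUpperSet_upSet F hxy hFx.mem_upSet
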